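/- arXiv:1201.6195 — 6 statements merged into one kernel-verified Lean document; each statement's English description precedes it below -/
import Mathlib

section
/- Let p > 3 be a prime and let A, B, C be integers with A ≥ 2, B ≥ 1, C ≥ 1. Then for all integers m ≥ 1 and r ≥ 1, the generalized Domb numbers satisfy the supercongruence D(m·p^r, A, B, C) ≡ D(m·p^(r-1), A, B, C) (mod p^(3r)). -/
/-- The generalized Domb numbers
`D(n, A, B, C) = ∑_{k=0}^{n} C(n,k)^A C(2k,k)^B C(2(n-k),n-k)^C`. -/
def genDomb (n A B C : ℕ) : ℕ :=
  ∑ k ∈ Finset.range (n + 1),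
    (n.choose k) ^ A * ((2 * k).choose k) ^ B * ((2 * (n - k)).choose (n - k)) ^ C

open Finset in
/-- Over the units of `ZMod q`, with `2` and `3` invertible, the inverse squares sum to zero. -/
theorem ZMod.sum_units_inv_sq_eq_zero {q : ℕ} [NeZero q] (h2 : Nat.Coprime 2 q)
    (h3 : Nat.Coprime 3 q) :
    ∑ u : (ZMod q)ˣ, ((u⁻¹ : (ZMod q)ˣ) : ZMod q) ^ 2 = 0 := by
  set S := ∑ u : (ZMod q)ˣ, ((u⁻¹ : (ZMod q)ˣ) : ZMod q) ^ 2
  have hinv : S = ∑ u : (ZMod q)ˣ, (u : ZMod q) ^ 2 :=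
    Fintype.sum_equiv (Equiv.inv _) _ _ fun u => by simp
  have key : S = 4 * S := by
    conv_lhs => rw [hinv, ← Equiv.sum_comp (Equiv.mulLeft (ZMod.unitOfCoprime 2 h2))]
    rw [hinv, mul_sum]
    refine sum_congr rfl fun u _ => ?_
    simp only [Equiv.coe_mulLeft, Units.val_mul, ZMod.coe_unitOfCoprime]
    push_cast
    ring
  have hu : IsUnit (3 : ZMod q) := by
    simpa using (ZMod.isUnit_iff_coprime 3 q).2 h3
  refine (hu.mul_right_eq_zero).1 ?_
  linear_combination -key

theorem Finset.prod_one_add_mul_of_sq_eq_zero {R ι : Type*} [CommRing R] (s : Finset ι) (E : R)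
    (hE : E ^ 2 = 0) (b : ι → R) :
    ∏ i ∈ s, (1 + E * b i) = 1 + E * ∑ i ∈ s, b i := by
  classical
  induction s using Finset.induction_on with
  | empty => simp
  | insert i s hi ih =>
    rw [Finset.prod_insert hi, Finset.sum_insert hi, ih]
    linear_combination b i * (∑ i ∈ s, b i) * hE

theorem ZMod.sq_mul_eq_zero_of_castHom_eq_zero {q : ℕ} [NeZero q] (y : ZMod (q ^ 3))
    (hy : ZMod.castHom (Dvd.intro_left (q ^ 2) rfl : q ∣ q ^ 3) (ZMod q) y = 0) :
    (q : ZMod (q ^ 3)) ^ 2 * y = 0 := by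
  obtain ⟨n, rfl⟩ := ZMod.natCast_zmod_surjective y
  rw [map_natCast, ZMod.natCast_eq_zero_iff] at hy
  obtain ⟨c, rfl⟩ := hy
  have : ((q ^ 3 : ℕ) : ZMod (q ^ 3)) = 0 := ZMod.natCast_self _
  push_cast at this ⊢
  linear_combination (c : ZMod (q ^ 3)) * this

/-- Modulo `q ^ 3`, the product of the integers prime to `q` in a block of `q` consecutive integers
does not depend on the block. -/
theorem ZMod.prod_units_add_val_modEq {q : ℕ} [NeZero q] (hq : 1 < q) (h2 : Nat.Coprime 2 q)
    (h3 : Nat.Coprime 3 q) (x : ℕ) :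
    ∏ u : (ZMod q)ˣ, (q * x + (u : ZMod q).val) ≡ ∏ u : (ZMod q)ˣ, (u : ZMod q).val
      [MOD q ^ 3] := by
  have : Fact (1 < q) := ⟨hq⟩
  have hq3 : ((q ^ 3 : ℕ) : ZMod (q ^ 3)) = 0 := ZMod.natCast_self _
  push_cast at hq3
  set a : (ZMod q)ˣ → ZMod (q ^ 3) := fun u => ((u : ZMod q).val : ZMod (q ^ 3)) with ha
  have ha_unit : ∀ u, IsUnit (a u) := fun u =>
    (ZMod.isUnit_iff_coprime _ _).2 (Nat.Coprime.pow_right 3 (ZMod.val_coe_unit_coprime u))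
  have ha_neg : ∀ u, a (-u) = q - a u := fun u => by
    have : NeZero (u : ZMod q) := ⟨u.ne_zero⟩
    simp only [ha, Units.val_neg]
    rw [ZMod.val_neg_of_ne_zero, Nat.cast_sub (ZMod.val_lt _).le]
  set L := ∏ u, ((q : ZMod (q ^ 3)) * x + a u) with hL
  set P := ∏ u, a u with hP
  suffices h : L = P by
    rw [← ZMod.natCast_eq_natCast_iff]
    push_cast
    exact h
  choose b hb using fun u => (ha_unit u).mul (ha_unit (-u))
  have hLsq : L ^ 2 = ∏ u, ((b u : ZMod (q ^ 3)) + q ^ 2 * (x * (x + 1))) := by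
    rw [sq]
    nth_rewrite 2 [hL]
    rw [← Equiv.prod_comp (Equiv.neg _), hL, ← Finset.prod_mul_distrib]
    refine Finset.prod_congr rfl fun u _ => ?_
    simp only [Equiv.neg_apply, hb, ha_neg]
    ring
  have hPsq : P ^ 2 = ∏ u, (b u : ZMod (q ^ 3)) := by
    rw [sq]
    nth_rewrite 2 [hP]
    rw [← Equiv.prod_comp (Equiv.neg _), hP, ← Finset.prod_mul_distrib]
    exact Finset.prod_congr rfl fun u _ => (hb u).symm
  have hsum : (q : ZMod (q ^ 3)) ^ 2 * ∑ u, ((b u)⁻¹ : (ZMod (q ^ 3))ˣ).val = 0 := by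
    apply ZMod.sq_mul_eq_zero_of_castHom_eq_zero
    rw [map_sum, ← neg_eq_zero, ← Finset.sum_neg_distrib, ← ZMod.sum_units_inv_sq_eq_zero h2 h3]
    refine Finset.sum_congr rfl fun u _ => ?_
    set φ := ZMod.castHom (Dvd.intro_left (q ^ 2) rfl : q ∣ q ^ 3) (ZMod q)
    have h1 : φ (b u) * φ ((b u)⁻¹ : (ZMod (q ^ 3))ˣ).val = 1 := by
      rw [← map_mul, Units.mul_inv, map_one]
    have h4 : φ (b u) = -(u : ZMod q) ^ 2 := by
      rw [hb, ha_neg]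
      simp only [ha, map_mul, map_sub, map_natCast, ZMod.natCast_self, ZMod.natCast_zmod_val]
      ring
    have h5 : (u : ZMod q) * ((u⁻¹ : (ZMod q)ˣ) : ZMod q) = 1 := Units.mul_inv u
    rw [h4] at h1
    generalize φ ((b u)⁻¹ : (ZMod (q ^ 3))ˣ).val = y at *
    generalize ((u⁻¹ : (ZMod q)ˣ) : ZMod q) = z at *
    linear_combination z ^ 2 * h1 + (y + y * u * z) * h5
  have hsq : L ^ 2 = P ^ 2 := by
    have hE : ((q : ZMod (q ^ 3)) ^ 2 * (x * (x + 1))) ^ 2 = 0 := by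
      linear_combination (q : ZMod (q ^ 3)) * (x * (x + 1)) ^ 2 * hq3
    have hfac : ∀ u, (b u : ZMod (q ^ 3)) + q ^ 2 * (x * (x + 1)) =
        b u * (1 + q ^ 2 * (x * (x + 1)) * ((b u)⁻¹ : (ZMod (q ^ 3))ˣ).val) := fun u => by
      linear_combination -(q : ZMod (q ^ 3)) ^ 2 * (x * (x + 1)) * (b u).mul_inv
    rw [hLsq, Finset.prod_congr rfl fun u _ => hfac u, Finset.prod_mul_distrib, ← hPsq,
      Finset.prod_one_add_mul_of_sq_eq_zero _ _ hE]
    linear_combination P ^ 2 * (x * (x + 1)) * hsum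
  have hunit : IsUnit (L + P) := by
    have hLP : L + P = ((∏ u : (ZMod q)ˣ, (q * x + (u : ZMod q).val) +
        ∏ u : (ZMod q)ˣ, (u : ZMod q).val : ℕ) : ZMod (q ^ 3)) := by
      push_cast
      rfl
    rw [hLP, ZMod.isUnit_iff_coprime]
    refine Nat.Coprime.pow_right 3 ((ZMod.isUnit_iff_coprime _ _).1 ?_)
    have h2u : IsUnit (2 : ZMod q) := by
      simpa using (ZMod.isUnit_iff_coprime 2 q).2 h2
    have : IsUnit (2 * ∏ u : (ZMod q)ˣ, (u : ZMod q)) :=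
      h2u.mul (IsUnit.prod_iff.2 fun u _ => u.isUnit)
    simpa [two_mul] using this
  refine sub_eq_zero.1 (hunit.mul_right_eq_zero.1 ?_)
  linear_combination hsq

/-- The product of the natural numbers below `n` that are not divisible by `p`. -/
def primeToPart (p n : ℕ) : ℕ :=
  ∏ j ∈ Finset.range n, if p ∣ j then 1 else j

theorem primeToPart_coprime {p : ℕ} (hp : p.Prime) (n : ℕ) : (primeToPart p n).Coprime p := by
  refine Nat.coprime_prod_left_iff.2 fun j _ => ?_
  split_ifs with h
  · exact Nat.coprime_one_left p
  · exact ((Nat.Prime.coprime_iff_not_dvd hp).2 h).symm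

theorem factorial_eq_primeToPart (p n : ℕ) :
    n.factorial = primeToPart p (n + 1) * (p ^ (n / p) * (n / p).factorial) := by
  induction n with
  | zero => simp [primeToPart]
  | succ n ih =>
    rw [Nat.factorial_succ, ih, primeToPart, primeToPart, Finset.prod_range_succ _ (n + 1),
      Nat.succ_div]
    split_ifs with h
    · have : n + 1 = p * (n / p + 1) := by
        rw [← Nat.succ_div_of_dvd h, Nat.mul_div_cancel' h]
      rw [Nat.factorial_succ, pow_succ]
      nth_rewrite 1 [this]
      ring
    · simp only [add_zero]
      ring

theorem factorial_mul_eq_primeToPart {p : ℕ} (hp : 0 < p) (n : ℕ) :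
    (p * n).factorial = primeToPart p (p * n) * (p ^ n * n.factorial) := by
  rw [factorial_eq_primeToPart p (p * n), Nat.mul_div_cancel_left n hp, primeToPart,
    Finset.prod_range_succ, if_pos (Dvd.intro n rfl), mul_one, primeToPart]

theorem choose_mul_primeToPart {p : ℕ} (hp : 0 < p) (b c : ℕ) :
    (p * (b + c)).choose (p * b) * (primeToPart p (p * b) * primeToPart p (p * c)) =
      (b + c).choose b * primeToPart p (p * (b + c)) := by
  have h1 := Nat.add_choose_mul_factorial_mul_factorial (p * b) (p * c)
  have h2 := Nat.add_choose_mul_factorial_mul_factorial b c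
  rw [← Nat.choose_symm_add] at h1 h2
  rw [← mul_add, factorial_mul_eq_primeToPart hp, factorial_mul_eq_primeToPart hp,
    factorial_mul_eq_primeToPart hp, ← h2, pow_add] at h1
  have h3 : 0 < p ^ b * p ^ c * b.factorial * c.factorial := by positivity
  refine Nat.eq_of_mul_eq_mul_right h3 ?_
  linear_combination h1

theorem prod_range_eq_prod_units {p : ℕ} (hp : p.Prime) (e : ℕ) [NeZero (p ^ (e + 1))]
    (f : ℕ → ℕ) :
    ∏ j ∈ Finset.range (p ^ (e + 1)), (if p ∣ j then 1 else f j) =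
      ∏ u : (ZMod (p ^ (e + 1)))ˣ, f (u : ZMod (p ^ (e + 1))).val := by
  rw [← Finset.prod_filter_mul_prod_filter_not _ (p ∣ ·), Finset.prod_congr rfl
    (g := fun _ => 1) fun j hj => if_pos (Finset.mem_filter.1 hj).2, Finset.prod_const_one,
    one_mul]
  symm
  refine Finset.prod_bij (fun u _ => (u : ZMod (p ^ (e + 1))).val) ?_ ?_ ?_ ?_
  · intro u _
    have := (Nat.coprime_pow_right_iff e.succ_pos _ _).1 (ZMod.val_coe_unit_coprime u)
    exact Finset.mem_filter.2 ⟨Finset.mem_range.2 (ZMod.val_lt _),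
      (Nat.Prime.coprime_iff_not_dvd hp).1 this.symm⟩
  · intro u _ v _ h
    exact Units.ext (ZMod.val_injective _ h)
  · intro j hj
    obtain ⟨hj, hpj⟩ := Finset.mem_filter.1 hj
    have hcop : j.Coprime (p ^ (e + 1)) :=
      Nat.Coprime.pow_right _ ((Nat.Prime.coprime_iff_not_dvd hp).2 hpj).symm
    refine ⟨ZMod.unitOfCoprime j hcop, Finset.mem_univ _, ?_⟩
    rw [ZMod.coe_unitOfCoprime, ZMod.val_natCast, Nat.mod_eq_of_lt (Finset.mem_range.1 hj)]
  · intro u _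
    have := (Nat.coprime_pow_right_iff e.succ_pos _ _).1 (ZMod.val_coe_unit_coprime u)
    rw [if_neg ((Nat.Prime.coprime_iff_not_dvd hp).1 this.symm)]

theorem primeToPart_modEq_pow {p : ℕ} (hp : p.Prime) (hp3 : 3 < p) (e n : ℕ) :
    primeToPart p (p ^ (e + 1) * n) ≡ primeToPart p (p ^ (e + 1)) ^ n
      [MOD (p ^ (e + 1)) ^ 3] := by
  have hq : 1 < p ^ (e + 1) := Nat.one_lt_pow e.succ_ne_zero hp.one_lt
  have : NeZero (p ^ (e + 1)) := ⟨by omega⟩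
  have hcop : ∀ k, k < p → k ≠ 0 → Nat.Coprime k (p ^ (e + 1)) := fun k h h0 =>
    Nat.Coprime.pow_right _
      (hp.coprime_iff_not_dvd.2 (Nat.not_dvd_of_pos_of_lt (Nat.pos_of_ne_zero h0) h)).symm
  induction n with
  | zero => simpa [primeToPart] using Nat.ModEq.refl _
  | succ n ih =>
    rw [mul_add, mul_one, pow_succ, primeToPart, Finset.prod_range_add]
    refine ih.mul ?_
    have hdvd : ∀ j, p ∣ p ^ (e + 1) * n + j ↔ p ∣ j := fun j =>
      Nat.dvd_add_right ((dvd_pow_self p e.succ_ne_zero).mul_right n)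
    simp only [hdvd, primeToPart]
    rw [prod_range_eq_prod_units hp e fun j => p ^ (e + 1) * n + j,
      prod_range_eq_prod_units hp e fun j => j]
    exact ZMod.prod_units_add_val_modEq hq (hcop 2 (by omega) (by omega))
      (hcop 3 (by omega) (by omega)) n

/-- `X` and `Y` agree up to a factor `v / u`, with `u` and `v` prime to `p` and congruent
modulo `M`. -/
def UnitCongr (p M X Y : ℕ) : Prop :=
  ∃ u v : ℕ, u.Coprime p ∧ u ≡ v [MOD M] ∧ X * u = Y * v

theorem UnitCongr.mul {p M X Y X' Y' : ℕ} (h : UnitCongr p M X Y) (h' : UnitCongr p M X' Y') :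
    UnitCongr p M (X * X') (Y * Y') := by
  obtain ⟨u, v, hu, huv, e⟩ := h
  obtain ⟨u', v', hu', huv', e'⟩ := h'
  refine ⟨u * u', v * v', hu.mul_left hu', huv.mul huv', ?_⟩
  linear_combination X' * u' * e + Y * v * e'

theorem UnitCongr.pow {p M X Y : ℕ} (h : UnitCongr p M X Y) (n : ℕ) :
    UnitCongr p M (X ^ n) (Y ^ n) := by
  obtain ⟨u, v, hu, huv, e⟩ := h
  exact ⟨u ^ n, v ^ n, hu.pow_left n, huv.pow n, by rw [← mul_pow, e, mul_pow]⟩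

theorem UnitCongr.modEq {p i j X Y : ℕ} (h : UnitCongr p (p ^ i) X Y) (hY : p ^ j ∣ Y) :
    X ≡ Y [MOD p ^ (j + i)] := by
  obtain ⟨u, v, hu, huv, e⟩ := h
  obtain ⟨c, rfl⟩ := hY
  have h1 : p ^ j * (c * v) ≡ p ^ j * (c * u) [MOD p ^ j * p ^ i] :=
    Nat.ModEq.mul_left' _ (huv.symm.mul_left c)
  refine Nat.ModEq.cancel_right_of_coprime (c := u) (hu.pow_right _).symm ?_
  rw [e, pow_add, mul_assoc, mul_assoc]
  exact h1

theorem unitCongr_choose {p : ℕ} (hp : p.Prime) (hp3 : 3 < p) (e : ℕ) {a b : ℕ} (hba : b ≤ a)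
    (ha : p ^ e ∣ a) (hb : p ^ e ∣ b) :
    UnitCongr p (p ^ (3 * (e + 1))) ((p * a).choose (p * b)) (a.choose b) := by
  obtain ⟨c, rfl⟩ := Nat.exists_eq_add_of_le hba
  have hc : p ^ e ∣ c := (Nat.dvd_add_right hb).1 ha
  refine ⟨_, _, ?_, ?_, choose_mul_primeToPart hp.pos b c⟩
  · exact (primeToPart_coprime hp _).mul_left (primeToPart_coprime hp _)
  · obtain ⟨b, rfl⟩ := hb
    obtain ⟨c, rfl⟩ := hc
    have h : ∀ n, p * (p ^ e * n) = p ^ (e + 1) * n := fun n => by ring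
    have hM : p ^ (3 * (e + 1)) = (p ^ (e + 1)) ^ 3 := by ring
    rw [← mul_add, h, h, h, hM]
    refine ((primeToPart_modEq_pow hp hp3 e b).mul (primeToPart_modEq_pow hp hp3 e c)).trans ?_
    rw [← pow_add]
    exact (primeToPart_modEq_pow hp hp3 e (b + c)).symm

theorem pow_sub_dvd_choose {p : ℕ} (hp : p.Prime) {n k r t : ℕ} (hn : p ^ r ∣ n)
    (hk : ¬ p ^ (t + 1) ∣ k) : p ^ (r - t) ∣ n.choose k := by
  obtain _ | k := k
  · simp at hk
  obtain _ | n := n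
  · simp
  have h : p ^ r ∣ (n + 1).choose (k + 1) * (k + 1) := by
    rw [← Nat.add_one_mul_choose_eq]
    exact hn.mul_right _
  obtain h0 | h0 := eq_or_ne ((n + 1).choose (k + 1)) 0
  · simp [h0]
  rw [hp.pow_dvd_iff_le_factorization (mul_ne_zero h0 k.succ_ne_zero),
    Nat.factorization_mul h0 k.succ_ne_zero, Finsupp.add_apply] at h
  rw [hp.pow_dvd_iff_le_factorization k.succ_ne_zero] at hk
  rw [hp.pow_dvd_iff_le_factorization h0]
  omega

theorem pow_sub_dvd_centralBinom_mul {p : ℕ} (hp : p.Prime) {n k r t : ℕ}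
    (hkn : k ≤ n) (hn : p ^ r ∣ n) (hk : ¬ p ^ (t + 1) ∣ k) :
    p ^ (r - t) ∣ (2 * k).choose k * (2 * (n - k)).choose (n - k) := by
  have h0 : ∀ j, (2 * j).choose j ≠ 0 := fun j => (Nat.choose_pos (by omega)).ne'
  rw [hp.pow_dvd_iff_le_factorization (mul_ne_zero (h0 _) (h0 _)),
    Nat.factorization_mul (h0 _) (h0 _), Finsupp.add_apply]
  set b := r + Nat.log p (2 * n) + 1 with hb
  have hlog : ∀ j ≤ n, Nat.log p (j + j) < b := fun j hj => by
    have : Nat.log p (j + j) ≤ Nat.log p (2 * n) := Nat.log_mono_right (by omega)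
    omega
  rw [two_mul, two_mul, Nat.factorization_choose' hp (hlog k hkn),
    Nat.factorization_choose' hp (hlog (n - k) (Nat.sub_le n k))]
  refine le_trans ?_ (Finset.card_union_le _ _)
  rw [← Nat.card_Ioc]
  refine Finset.card_le_card fun i hi => ?_
  obtain ⟨hti, hir⟩ := Finset.mem_Ioc.1 hi
  rw [Finset.mem_union, Finset.mem_filter, Finset.mem_filter, ← and_or_left, Finset.mem_Ico]
  refine ⟨⟨by omega, by omega⟩, ?_⟩
  have hin : p ^ i ∣ n := (pow_dvd_pow p hir).trans hn
  have hsum : p ^ i ∣ k % p ^ i + (n - k) % p ^ i := by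
    rw [Nat.dvd_iff_mod_eq_zero, ← Nat.add_mod, Nat.add_sub_cancel' hkn]
    exact Nat.mod_eq_zero_of_dvd hin
  have hpos : 0 < k % p ^ i := Nat.pos_of_ne_zero fun h =>
    hk ((pow_dvd_pow p hti).trans (Nat.dvd_of_mod_eq_zero h))
  have := Nat.le_of_dvd (Nat.add_pos_left hpos _) hsum
  omega

/-- The summand of `genDomb`. -/
def genDombTerm (n k A B C : ℕ) : ℕ :=
  n.choose k ^ A * (2 * k).choose k ^ B * (2 * (n - k)).choose (n - k) ^ C

theorem pow_dvd_genDombTerm {p : ℕ} (hp : p.Prime) {A B C n k r t : ℕ}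
    (hA : 2 ≤ A) (hB : 1 ≤ B) (hC : 1 ≤ C) (hkn : k ≤ n) (hn : p ^ r ∣ n)
    (hk : ¬ p ^ (t + 1) ∣ k) : p ^ (3 * (r - t)) ∣ genDombTerm n k A B C := by
  have h1 : p ^ (2 * (r - t)) ∣ n.choose k ^ A := by
    rw [mul_comm, pow_mul]
    exact (pow_dvd_pow_of_dvd (pow_sub_dvd_choose hp hn hk) 2).trans (pow_dvd_pow _ hA)
  have h2 : p ^ (r - t) ∣ (2 * k).choose k ^ B * (2 * (n - k)).choose (n - k) ^ C :=
    (pow_sub_dvd_centralBinom_mul hp hkn hn hk).trans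
      (mul_dvd_mul (dvd_pow_self _ (by omega)) (dvd_pow_self _ (by omega)))
  rw [genDombTerm, mul_assoc, show 3 * (r - t) = 2 * (r - t) + (r - t) by ring, pow_add]
  exact mul_dvd_mul h1 h2

theorem genDombTerm_mul_modEq {p : ℕ} (hp : p.Prime) (hp3 : 3 < p) {A B C n k r : ℕ}
    (hA : 2 ≤ A) (hB : 1 ≤ B) (hC : 1 ≤ C) (hkn : k ≤ n) (hn : p ^ r ∣ n) :
    genDombTerm (p * n) (p * k) A B C ≡ genDombTerm n k A B C [MOD p ^ (3 * (r + 1))] := by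
  have key : ∀ t ≤ r, p ^ t ∣ k →
      UnitCongr p (p ^ (3 * (t + 1))) (genDombTerm (p * n) (p * k) A B C)
        (genDombTerm n k A B C) := fun t htr hk => by
    have hn' : p ^ t ∣ n := (pow_dvd_pow p htr).trans hn
    have hnk : p ^ t ∣ n - k := Nat.dvd_sub hn' hk
    rw [genDombTerm, genDombTerm, ← Nat.mul_sub, mul_left_comm 2 p, mul_left_comm 2 p]
    exact (((unitCongr_choose hp hp3 t hkn hn' hk).pow A).mul
      ((unitCongr_choose hp hp3 t (by omega) (hk.mul_left 2) hk).pow B)).mul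
      ((unitCongr_choose hp hp3 t (by omega) (hnk.mul_left 2) hnk).pow C)
  by_cases hr : p ^ r ∣ k
  · simpa using (key r le_rfl hr).modEq (j := 0) (by simp)
  · obtain ⟨t, ht, hmax⟩ : ∃ t, p ^ t ∣ k ∧ ¬ p ^ (t + 1) ∣ k := by
      by_contra! h
      exact hr (Nat.rec (by simp) h r)
    have htr : t < r := lt_of_not_ge fun h => hr ((pow_dvd_pow p h).trans ht)
    have := (key t htr.le ht).modEq
      (pow_dvd_genDombTerm hp hA hB hC hkn hn hmax)
    rwa [show 3 * (r - t) + 3 * (t + 1) = 3 * (r + 1) by omega] at this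

theorem Finset.sum_range_mul_filter_dvd {p : ℕ} (hp : 0 < p) (n : ℕ) (f : ℕ → ℕ) :
    ∑ k ∈ (Finset.range (p * n + 1)).filter (p ∣ ·), f k =
      ∑ k ∈ Finset.range (n + 1), f (p * k) := by
  symm
  refine Finset.sum_bij (fun k _ => p * k) ?_ ?_ ?_ fun _ _ => rfl
  · intro k hk
    simp only [Finset.mem_filter, Finset.mem_range, dvd_mul_right, and_true,
      Nat.lt_add_one_iff] at hk ⊢
    exact Nat.mul_le_mul_left p hk
  · intro a _ b _ h
    exact Nat.eq_of_mul_eq_mul_left hp h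
  · intro k hk
    simp only [Finset.mem_filter, Finset.mem_range, Nat.lt_add_one_iff] at hk
    obtain ⟨hk, j, rfl⟩ := hk
    exact ⟨j, Finset.mem_range.2 (Nat.lt_add_one_iff.2 (Nat.le_of_mul_le_mul_left hk hp)), rfl⟩

theorem genDomb_supercongruence (p : ℕ) (hp : p.Prime) (hp3 : 3 < p)
    (A B C : ℕ) (hA : 2 ≤ A) (hB : 1 ≤ B) (hC : 1 ≤ C)
    (m r : ℕ) (hm : 1 ≤ m) (hr : 1 ≤ r) :
    genDomb (m * p ^ r) A B C ≡ genDomb (m * p ^ (r - 1)) A B C [MOD p ^ (3 * r)] := by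
  obtain ⟨r, rfl⟩ : ∃ s, r = s + 1 := ⟨r - 1, by omega⟩
  have hpn : m * p ^ (r + 1) = p * (m * p ^ r) := by ring
  rw [Nat.add_sub_cancel, hpn]
  have hn : p ^ r ∣ m * p ^ r := dvd_mul_left _ _
  have hn' : p ^ (r + 1) ∣ p * (m * p ^ r) := hpn ▸ dvd_mul_left _ _
  generalize m * p ^ r = n at *
  change ∑ k ∈ Finset.range (p * n + 1), genDombTerm (p * n) k A B C ≡
    ∑ k ∈ Finset.range (n + 1), genDombTerm n k A B C [MOD p ^ (3 * (r + 1))]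
  rw [← Finset.sum_filter_add_sum_filter_not _ (p ∣ ·), Finset.sum_range_mul_filter_dvd hp.pos]
  have h0 : ∑ k ∈ (Finset.range (p * n + 1)).filter (¬ p ∣ ·), genDombTerm (p * n) k A B C ≡ 0
      [MOD p ^ (3 * (r + 1))] := by
    refine Nat.modEq_zero_iff_dvd.2 (Finset.dvd_sum fun k hk => ?_)
    obtain ⟨hk, hpk⟩ := Finset.mem_filter.1 hk
    exact pow_dvd_genDombTerm (t := 0) hp hA hB hC
      (Nat.lt_add_one_iff.1 (Finset.mem_range.1 hk)) hn' (by simpa using hpk)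
  refine Nat.ModEq.add (Nat.ModEq.sum fun k hk => ?_) h0
  exact genDombTerm_mul_modEq hp hp3 hA hB hC (Nat.lt_add_one_iff.1 (Finset.mem_range.1 hk)) hn
end

section
/- Let p > 3 be a prime. Then for all integers m ≥ 1 and r ≥ 1, the numbers D(n,1,1,1) satisfy the supercongruence D(m·p^r, 1, 1, 1) ≡ D(m·p^(r-1), 1, 1, 1) (mod p^(2r)). -/
/-- The super Catalan numbers `(2k)! (2l)! / (k! l! (k + l)!)` are integers. -/
theorem exists_superCatalan (k l : ℕ) :
    ∃ z : ℤ, ((2 * k).factorial : ℤ) * (2 * l).factorial =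
      z * (k.factorial * l.factorial * (k + l).factorial) := by
  induction k generalizing l with
  | zero =>
    refine ⟨(2 * l).choose l, ?_⟩
    have h := Nat.choose_mul_factorial_mul_factorial (show l ≤ 2 * l by omega)
    rw [show 2 * l - l = l by omega] at h
    simp only [Nat.mul_zero, Nat.factorial_zero, Nat.cast_one, one_mul, Nat.zero_add]
    rw [← h]
    push_cast
    ring
  | succ k ih =>
    obtain ⟨a, ha⟩ := ih l
    obtain ⟨b, hb⟩ := ih (l + 1)
    refine ⟨4 * a - b, ?_⟩
    rw [show 2 * (l + 1) = 2 * l + 1 + 1 by ring, show k + (l + 1) = k + l + 1 by ring] at hb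
    rw [show 2 * (k + 1) = 2 * k + 1 + 1 by ring, show k + 1 + l = k + l + 1 by ring]
    simp only [Nat.factorial_succ] at hb ⊢
    push_cast at ha hb ⊢
    have hl : (l : ℤ) + 1 ≠ 0 := by positivity
    refine mul_left_cancel₀ hl ?_
    linear_combination (4 * ((l : ℤ) + 1) * (k + 1) * (k + l + 1)) * ha - (k + 1) * hb

/-- The summand of `genDomb (k + l) 1 1 1` at the index `k`. -/
def dombTerm (k l : ℕ) : ℕ :=
  (k + l).choose k * (2 * k).choose k * (2 * l).choose l

theorem dombTerm_mul_factorial (k l : ℕ) :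
    dombTerm k l * (k.factorial ^ 3 * l.factorial ^ 3) =
      (k + l).factorial * (2 * k).factorial * (2 * l).factorial := by
  have h1 := Nat.choose_mul_factorial_mul_factorial (show k ≤ k + l by omega)
  have h2 := Nat.choose_mul_factorial_mul_factorial (show k ≤ 2 * k by omega)
  have h3 := Nat.choose_mul_factorial_mul_factorial (show l ≤ 2 * l by omega)
  rw [show k + l - k = l by omega] at h1
  rw [show 2 * k - k = k by omega] at h2
  rw [show 2 * l - l = l by omega] at h3
  rw [← h1, ← h2, ← h3, dombTerm]
  ring

theorem choose_sq_dvd_dombTerm (k l : ℕ) : (k + l).choose k ^ 2 ∣ dombTerm k l := by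
  obtain ⟨z, hz⟩ := exists_superCatalan k l
  have h1 := Nat.choose_mul_factorial_mul_factorial (show k ≤ k + l by omega)
  rw [show k + l - k = l by omega] at h1
  have hT := dombTerm_mul_factorial k l
  zify at h1 hT ⊢
  refine ⟨z, ?_⟩
  have hne : ((k.factorial : ℤ) ^ 3 * l.factorial ^ 3) ≠ 0 := by positivity
  refine mul_right_cancel₀ hne ?_
  rw [hT, mul_assoc, hz, ← h1]
  ring

theorem exists_pow_dvd_dombTerm {p : ℕ} (hp : p.Prime) {R k l : ℕ} (h : p ^ R ∣ k + l) :
    ∃ s ≤ R, p ^ s ∣ k ∧ p ^ s ∣ l ∧ p ^ (2 * (R - s)) ∣ dombTerm k l := by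
  by_cases hk : p ^ R ∣ k
  · exact ⟨R, le_rfl, hk, (Nat.dvd_add_right hk).1 h, by simp⟩
  have hk0 : k ≠ 0 := by
    rintro rfl
    exact hk (dvd_zero _)
  obtain ⟨s, u, hu, hku⟩ := Nat.exists_eq_pow_mul_and_not_dvd hk0 p hp.ne_one
  have hs : s < R := by
    by_contra! hs
    exact hk (hku ▸ (pow_dvd_pow p hs).mul_right u)
  have hsk : p ^ s ∣ k := ⟨u, hku⟩
  refine ⟨s, hs.le, hsk, (Nat.dvd_add_right hsk).1 ((pow_dvd_pow p hs.le).trans h), ?_⟩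
  refine Dvd.dvd.trans ?_ (choose_sq_dvd_dombTerm k l)
  rw [mul_comm 2, pow_mul]
  refine pow_dvd_pow_of_dvd ?_ 2
  obtain ⟨j, rfl⟩ := Nat.exists_eq_succ_of_ne_zero hk0
  have hmul := Nat.add_one_mul_choose_eq (j + l) j
  rw [show j + l + 1 = j.succ + l by omega] at hmul
  have hd : p ^ R ∣ (j.succ + l).choose j.succ * (j + 1) := hmul ▸ h.mul_right _
  rw [show j + 1 = p ^ s * u from hku, mul_left_comm, ← Nat.add_sub_cancel' hs.le, pow_add] at hd
  have hd' := Nat.dvd_of_mul_dvd_mul_left (pow_pos hp.pos s) hd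
  exact ((hp.coprime_iff_not_dvd.2 hu).pow_left _).dvd_of_dvd_mul_right hd'

/-- The product of the numbers below `p * N` that are not divisible by `p`. -/
def primeToFactorial (p N : ℕ) : ℕ :=
  ∏ j ∈ Finset.range (p * N) with ¬ p ∣ j, j

theorem coprime_primeToFactorial {p : ℕ} (hp : p.Prime) (N : ℕ) :
    p.Coprime (primeToFactorial p N) :=
  Nat.Coprime.prod_right fun _ hj => hp.coprime_iff_not_dvd.2 (Finset.mem_filter.1 hj).2

theorem primeToFactorial_add (p N M : ℕ) :
    primeToFactorial p (N + M) =
      primeToFactorial p N * ∏ j ∈ Finset.range (p * M) with ¬ p ∣ j, (p * N + j) := by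
  simp only [primeToFactorial, Finset.prod_filter, mul_add, Finset.prod_range_add]
  simp [Nat.dvd_add_right]

theorem factorial_mul_eq {p : ℕ} (hp : p.Prime) (N : ℕ) :
    (p * N).factorial = p ^ N * N.factorial * primeToFactorial p N := by
  induction N with
  | zero => simp [primeToFactorial]
  | succ N ih =>
    have hblock : ∏ j ∈ Finset.range p, (p * N + j + 1) =
        p * (N + 1) * ∏ j ∈ Finset.range p with ¬ p ∣ j, (p * N + j) := by
      obtain ⟨q, rfl⟩ := Nat.exists_eq_succ_of_ne_zero hp.ne_zero
      rw [Finset.prod_filter, Finset.prod_range_succ, Finset.prod_range_succ']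
      have : ∀ j ∈ Finset.range q, (if ¬ q.succ ∣ j + 1 then q.succ * N + (j + 1) else 1) =
          q.succ * N + j + 1 := by
        intro j hj
        rw [if_pos, add_assoc]
        exact Nat.not_dvd_of_pos_of_lt j.succ_pos (Nat.succ_lt_succ (Finset.mem_range.1 hj))
      rw [Finset.prod_congr rfl this]
      simp
      ring
    have hfac : (p * N + p).factorial =
        (p * N).factorial * ∏ j ∈ Finset.range p, (p * N + j + 1) := by
      rw [← Nat.factorial_mul_ascFactorial, Nat.ascFactorial_eq_prod_range]
      congr 1
      exact Finset.prod_congr rfl fun j _ => by ring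
    rw [mul_add, mul_one, hfac, ih, hblock, primeToFactorial_add, mul_one, Nat.factorial_succ]
    ring

theorem prod_shift_modEq {p : ℕ} (hp : p.Prime) (hp2 : 2 < p) (s t : ℕ) :
    ∏ j ∈ Finset.range (p ^ (s + 1)) with ¬ p ∣ j, (t * p ^ (s + 1) + j) ≡
      ∏ j ∈ Finset.range (p ^ (s + 1)) with ¬ p ∣ j, j [MOD p ^ (2 * (s + 1))] := by
  set q := p ^ (s + 1) with hq
  have hpq : p ∣ q := dvd_pow_self p s.succ_ne_zero
  set S := Finset.filter (fun j => ¬ p ∣ j) (Finset.range q) with hS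
  have hreflect (f : ℕ → ℤ) : ∏ j ∈ S, f (q - j) = ∏ j ∈ S, f j := by
    have hmaps : ∀ j ∈ S, q - j ∈ S := by
      intro j hj
      obtain ⟨hj1, hj2⟩ := Finset.mem_filter.1 hj
      have hjq := Finset.mem_range.1 hj1
      have hj0 : j ≠ 0 := by
        rintro rfl
        exact hj2 (dvd_zero p)
      refine Finset.mem_filter.2 ⟨Finset.mem_range.2 (by omega), fun hd => hj2 ?_⟩
      exact (Nat.dvd_sub_iff_right hjq.le hpq).1 hd
    have hinv : ∀ j ∈ S, q - (q - j) = j := fun j hj =>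
      Nat.sub_sub_self (Finset.mem_range.1 (Finset.mem_filter.1 hj).1).le
    exact Finset.prod_nbij' (q - ·) (q - ·) hmaps hmaps hinv hinv fun _ _ => rfl
  set A : ℤ := ∏ j ∈ S, ((t : ℤ) * q + j) with hA
  set B : ℤ := ∏ j ∈ S, (j : ℤ) with hB
  have hsq : A * A ≡ B * B [ZMOD (q : ℤ) ^ 2] := by
    have h1 : A * A = ∏ j ∈ S, (((t : ℤ) * q + j) * (t * q + (q - j : ℕ))) := by
      rw [Finset.prod_mul_distrib, hreflect fun j => (t : ℤ) * q + j]
    have h2 : B * B = ∏ j ∈ S, ((j : ℤ) * (q - j : ℕ)) := by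
      rw [Finset.prod_mul_distrib, hreflect fun j => (j : ℤ)]
    rw [h1, h2]
    refine Int.ModEq.prod fun j hj => ?_
    rw [Nat.cast_sub (Finset.mem_range.1 (Finset.mem_filter.1 hj).1).le]
    refine (Int.modEq_iff_dvd.2 ⟨t * (t + 1), ?_⟩).symm
    ring
  have hmod : A ≡ B [ZMOD p] := by
    refine Int.ModEq.prod fun j _ => ?_
    refine (Int.modEq_iff_dvd.2 ?_).symm
    rw [add_sub_cancel_right]
    exact (Int.natCast_dvd_natCast.2 hpq).mul_left _
  have hpZ : Prime (p : ℤ) := Nat.prime_iff_prime_int.1 hp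
  have hpB : ¬ (p : ℤ) ∣ B := by
    rw [hB, hpZ.dvd_finsetProd_iff]
    rintro ⟨j, hj, hd⟩
    exact (Finset.mem_filter.1 hj).2 (Int.natCast_dvd_natCast.1 hd)
  have hsum : ¬ (p : ℤ) ∣ B + A := by
    intro hd
    have h2B : (p : ℤ) ∣ 2 * B := by
      have := dvd_add hd hmod.dvd
      rwa [show B + A + (B - A) = 2 * B by ring] at this
    rcases hpZ.dvd_or_dvd h2B with h | h
    · have := Int.le_of_dvd two_pos h
      omega
    · exact hpB h
  have hdvd : (p : ℤ) ^ (2 * (s + 1)) ∣ (B + A) * (B - A) := by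
    have := hsq.dvd
    rw [hq, Nat.cast_pow, ← pow_mul, mul_comm (s + 1)] at this
    rwa [show (B + A) * (B - A) = B * B - A * A by ring]
  have hfin : (p : ℤ) ^ (2 * (s + 1)) ∣ B - A := hpZ.pow_dvd_of_dvd_mul_left _ hsum hdvd
  rw [← Int.natCast_modEq_iff, Int.modEq_iff_dvd]
  push_cast
  exact hfin

theorem primeToFactorial_modEq_pow {p : ℕ} (hp : p.Prime) (hp2 : 2 < p) (s M : ℕ) :
    primeToFactorial p (p ^ s * M) ≡ primeToFactorial p (p ^ s) ^ M [MOD p ^ (2 * (s + 1))] := by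
  induction M with
  | zero => simp [primeToFactorial, Nat.ModEq.refl]
  | succ M ih =>
    rw [mul_add_one (p ^ s), primeToFactorial_add, pow_succ]
    refine ih.mul ?_
    have h := prod_shift_modEq hp hp2 s M
    rw [primeToFactorial, ← pow_succ', ← mul_assoc, ← pow_succ', mul_comm _ M]
    exact h

theorem dombTerm_mul_mul {p : ℕ} (hp : p.Prime) (k l : ℕ) :
    dombTerm (p * k) (p * l) * (primeToFactorial p k ^ 3 * primeToFactorial p l ^ 3) =
      dombTerm k l * (primeToFactorial p (k + l) * primeToFactorial p (2 * k) *
        primeToFactorial p (2 * l)) := by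
  have h := dombTerm_mul_factorial (p * k) (p * l)
  have h' := dombTerm_mul_factorial k l
  rw [← mul_add, mul_left_comm 2, mul_left_comm 2] at h
  simp only [factorial_mul_eq hp] at h
  have hne : 0 < p ^ (3 * (k + l)) * (k.factorial ^ 3 * l.factorial ^ 3) := by
    have := hp.pos
    positivity
  refine Nat.eq_of_mul_eq_mul_left hne ?_
  calc
    _ = dombTerm (p * k) (p * l) * ((p ^ k * k.factorial * primeToFactorial p k) ^ 3 *
          (p ^ l * l.factorial * primeToFactorial p l) ^ 3) := by ring
    _ = p ^ (3 * (k + l)) * ((k + l).factorial * (2 * k).factorial * (2 * l).factorial) *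
          (primeToFactorial p (k + l) * primeToFactorial p (2 * k) *
            primeToFactorial p (2 * l)) := by
      rw [h]
      ring
    _ = _ := by
      rw [← h']
      ring

theorem dombTerm_modEq {p : ℕ} (hp : p.Prime) (hp2 : 2 < p) {R k l : ℕ} (h : p ^ R ∣ k + l) :
    dombTerm (p * k) (p * l) ≡ dombTerm k l [MOD p ^ (2 * (R + 1))] := by
  obtain ⟨s, hs, ⟨a, rfl⟩, ⟨b, rfl⟩, c, hc⟩ := exists_pow_dvd_dombTerm hp h
  set G := primeToFactorial p (p ^ s * a) ^ 3 * primeToFactorial p (p ^ s * b) ^ 3 with hG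
  have hcop : (p ^ (2 * (R + 1))).gcd G = 1 :=
    Nat.Coprime.pow_left _ (Nat.Coprime.mul_right
      ((coprime_primeToFactorial hp _).pow_right 3) ((coprime_primeToFactorial hp _).pow_right 3))
  refine Nat.ModEq.cancel_right_of_coprime hcop ?_
  rw [hG, dombTerm_mul_mul hp, hc, ← hG, show 2 * (R + 1) = 2 * (R - s) + 2 * (s + 1) by omega,
    pow_add, mul_assoc _ c, mul_assoc _ c]
  refine Nat.ModEq.mul_left' _ (Nat.ModEq.mul_left c ?_)
  rw [← mul_add, mul_left_comm 2, mul_left_comm 2]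
  have key := primeToFactorial_modEq_pow hp hp2 s
  refine (((key (a + b)).mul (key (2 * a))).mul (key (2 * b))).trans ?_
  refine Nat.ModEq.trans ?_ (((key a).pow 3).mul ((key b).pow 3)).symm
  refine congrArg (· % _) ?_
  ring

theorem genDomb_one_one_one (n : ℕ) :
    genDomb n 1 1 1 = ∑ k ∈ Finset.range (n + 1), dombTerm k (n - k) := by
  refine Finset.sum_congr rfl fun k hk => ?_
  rw [dombTerm, Nat.add_sub_cancel' (Finset.mem_range_succ_iff.1 hk)]
  simp only [pow_one]

theorem domb111_supercongruence (p : ℕ) (hp : p.Prime) (hp3 : 3 < p)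
    (m r : ℕ) (hm : 1 ≤ m) (hr : 1 ≤ r) :
    genDomb (m * p ^ r) 1 1 1 ≡ genDomb (m * p ^ (r - 1)) 1 1 1 [MOD p ^ (2 * r)] := by
  obtain ⟨R, rfl⟩ := Nat.exists_eq_add_of_le' hr
  rw [Nat.add_sub_cancel, show m * p ^ (R + 1) = p * (m * p ^ R) by ring]
  set n := m * p ^ R with hn
  have hpn : p ^ R ∣ n := ⟨m, mul_comm _ _⟩
  rw [genDomb_one_one_one, genDomb_one_one_one, ← ZMod.natCast_eq_natCast_iff]
  push_cast
  have hinj : Set.InjOn (p * ·) (Finset.range (n + 1) : Set ℕ) :=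
    fun _ _ _ _ hxy => Nat.eq_of_mul_eq_mul_left hp.pos hxy
  have hsub : (Finset.range (n + 1)).image (p * ·) ⊆ Finset.range (p * n + 1) := by
    intro x hx
    obtain ⟨k, hk, rfl⟩ := Finset.mem_image.1 hx
    exact Finset.mem_range_succ_iff.2 (Nat.mul_le_mul_left p (Finset.mem_range_succ_iff.1 hk))
  rw [← Finset.sum_subset hsub, Finset.sum_image hinj]
  · refine Finset.sum_congr rfl fun k hk => ?_
    rw [← Nat.mul_sub, ZMod.natCast_eq_natCast_iff]
    refine dombTerm_modEq hp (by omega) ?_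
    rwa [Nat.add_sub_cancel' (Finset.mem_range_succ_iff.1 hk)]
  · intro k hk hk'
    have hkn := Finset.mem_range_succ_iff.1 hk
    have hdvd : p ^ (R + 1) ∣ k + (p * n - k) := by
      rw [Nat.add_sub_cancel' hkn, pow_succ']
      exact Nat.mul_dvd_mul_left p hpn
    obtain ⟨s, -, hsk, -, hT⟩ := exists_pow_dvd_dombTerm hp hdvd
    have hs : s = 0 := by
      by_contra hs
      obtain ⟨j, rfl⟩ := (dvd_pow_self p hs).trans hsk
      exact hk' (Finset.mem_image.2 ⟨j, Finset.mem_range_succ_iff.2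
        (Nat.le_of_mul_le_mul_left hkn hp.pos), rfl⟩)
    rw [ZMod.natCast_eq_zero_iff]
    simpa [hs] using hT
end

section
/- Let p > 3 be a prime and j ≥ 1 an integer with j not divisible by p − 1. Then for all integers m ≥ 1 and r ≥ 1, the p-adic valuation of the rational number S_j(m·p^r) is at least r (i.e., S_j(m·p^r) ≡ 0 (mod p^r) in the p-adic sense). -/
/-- `S_j(k) = ∑_{1 ≤ i ≤ k, p ∤ i} 1 / i^j` as a rational number. -/
def Ssum (p j k : ℕ) : ℚ :=
  ∑ i ∈ (Finset.Icc 1 k).filter (fun i => ¬ p ∣ i), 1 / (i : ℚ) ^ j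

open Finset in
theorem ZMod.sum_range_natCast {M : Type*} [AddCommMonoid M] (n : ℕ) [NeZero n] (f : ZMod n → M) :
    ∑ i ∈ range n, f (i : ZMod n) = ∑ a : ZMod n, f a :=
  sum_nbij' (fun i => (i : ZMod n)) ZMod.val (by simp) (by simp [ZMod.val_lt])
    (fun i hi => ZMod.val_cast_of_lt (mem_range.1 hi)) (by simp) (by simp)

open Finset in
theorem ZMod.sum_range_mul_natCast {M : Type*} [AddCommMonoid M] (n : ℕ) [NeZero n]
    (f : ZMod n → M) (m : ℕ) :
    ∑ i ∈ range (m * n), f (i : ZMod n) = m • ∑ a : ZMod n, f a := by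
  induction m with
  | zero => simp
  | succ m ih =>
    rw [Nat.succ_mul, sum_range_add, ih, succ_nsmul, ← ZMod.sum_range_natCast]
    simp

/-- A sum of `j`-th powers over the units of a finite ring vanishes as soon as some unit `g`
makes `g ^ j - 1` a unit. -/
theorem Units.sum_pow_eq_zero {R : Type*} [CommRing R] [Fintype Rˣ] (j : ℕ) (g : Rˣ)
    (hg : IsUnit ((g : R) ^ j - 1)) : ∑ u : Rˣ, (u : R) ^ j = 0 := by
  have h : ∑ u : Rˣ, ((g * u : Rˣ) : R) ^ j = ∑ u : Rˣ, (u : R) ^ j :=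
    Equiv.sum_comp (Equiv.mulLeft g) fun u : Rˣ => (u : R) ^ j
  simp only [Units.val_mul, mul_pow, ← Finset.mul_sum] at h
  refine hg.mul_right_eq_zero.1 ?_
  rw [sub_mul, h, one_mul, sub_self]

theorem PadicInt.isUnit_iff_toZMod_ne_zero {p : ℕ} [Fact p.Prime] {x : ℤ_[p]} :
    IsUnit x ↔ PadicInt.toZMod x ≠ 0 := by
  rw [ne_eq, ← RingHom.mem_ker, PadicInt.ker_toZMod, IsLocalRing.mem_maximalIdeal,
    mem_nonunits_iff, not_not]

theorem ZMod.exists_unit_isUnit_pow_sub_one {p : ℕ} [Fact p.Prime] {j : ℕ} (hj : ¬ (p - 1) ∣ j)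
    (r : ℕ) : ∃ g : (ZMod (p ^ r))ˣ, IsUnit ((g : ZMod (p ^ r)) ^ j - 1) := by
  obtain ⟨v, hv⟩ : ∃ v : (ZMod p)ˣ, v ^ j ≠ 1 := by
    by_contra! h
    exact hj (by simpa [ZMod.card] using (FiniteField.forall_pow_eq_one_iff (ZMod p) j).1 h)
  obtain ⟨x, hx⟩ := ZMod.ringHom_surjective (PadicInt.toZMod (p := p)) v
  have hxu : IsUnit x := PadicInt.isUnit_iff_toZMod_ne_zero.2 (hx ▸ v.ne_zero)
  have hxj : IsUnit (x ^ j - 1) := by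
    rw [PadicInt.isUnit_iff_toZMod_ne_zero, map_sub, map_pow, hx, map_one, sub_ne_zero]
    rwa [← Units.val_pow_eq_pow_val, ne_eq, Units.val_eq_one]
  refine ⟨(hxu.map (PadicInt.toZModPow r)).unit, ?_⟩
  simpa using hxj.map (PadicInt.toZModPow r)

theorem ZMod.sum_range_filter_inv_pow_eq_zero {p : ℕ} [Fact p.Prime] {j : ℕ}
    (hj : ¬ (p - 1) ∣ j) (m : ℕ) {r : ℕ} (hr : r ≠ 0) :
    ∑ i ∈ (Finset.range (m * p ^ r)).filter (fun i => ¬ p ∣ i), ((i : ZMod (p ^ r))⁻¹) ^ j = 0 := by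
  classical
  have hunit (i : ℕ) : ¬ p ∣ i ↔ IsUnit (i : ZMod (p ^ r)) :=
    (ZMod.isUnit_natCast_iff_not_dvd_pow Fact.out (Nat.pos_of_ne_zero hr)).symm
  obtain ⟨g, hg⟩ := ZMod.exists_unit_isUnit_pow_sub_one hj r
  simp only [hunit]
  rw [Finset.sum_filter, ZMod.sum_range_mul_natCast (p ^ r)
    (fun a : ZMod (p ^ r) => if IsUnit a then a⁻¹ ^ j else 0), ← Finset.sum_filter]
  have h : ∑ a : ZMod (p ^ r) with IsUnit a, a⁻¹ ^ j =
      ∑ u : (ZMod (p ^ r))ˣ, (u : ZMod (p ^ r)) ^ j :=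
    (Finset.sum_bij (fun u _ => ((u⁻¹ : (ZMod (p ^ r))ˣ) : ZMod (p ^ r))) (by simp)
      (fun u _ v _ h => inv_injective (Units.ext h)) (fun a ha => by
        obtain ⟨u, rfl⟩ := (Finset.mem_filter.1 ha).2
        exact ⟨u⁻¹, Finset.mem_univ _, by simp⟩)
      (fun u _ => by rw [ZMod.inv_coe_unit, inv_inv])).symm
  rw [h, Units.sum_pow_eq_zero j g hg, smul_zero]

/-- Coster's Lemma: `S_j(m p^r) ≡ 0 (mod p^r)` when `(p-1) ∤ j`, i.e. the
`p`-adic norm of `S_j(m p^r)` is at most `p^(-r)`. -/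
theorem Ssum_padic_congruence (p : ℕ) (hp : p.Prime) (hp3 : 3 < p)
    (j : ℕ) (hj : 1 ≤ j) (hjd : ¬ (p - 1) ∣ j)
    (m r : ℕ) (hm : 1 ≤ m) (hr : 1 ≤ r) :
    padicNorm p (Ssum p j (m * p ^ r)) ≤ (p : ℚ) ^ (-(r : ℤ)) := by
  have := Fact.mk hp
  have hr0 : r ≠ 0 := Nat.one_le_iff_ne_zero.1 hr
  have hIcc : (Finset.Icc 1 (m * p ^ r)).filter (fun i => ¬ p ∣ i) =
      (Finset.range (m * p ^ r)).filter (fun i => ¬ p ∣ i) := by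
    ext i
    simp only [Finset.mem_filter, Finset.mem_Icc, Finset.mem_range, and_congr_left_iff]
    intro hi
    have h0 : i ≠ 0 := fun h => hi (h ▸ dvd_zero p)
    have hN : i ≠ m * p ^ r := fun h => hi (h ▸ (dvd_pow_self p hr0).mul_left m)
    omega
  have hnorm {i : ℕ} (hi : ¬ p ∣ i) : ‖(i : ℤ_[p])‖ = 1 := by
    rw [← PadicInt.isUnit_iff, PadicInt.isUnit_iff_toZMod_ne_zero, map_natCast, ne_eq,
      ZMod.natCast_eq_zero_iff]
    exact hi
  set s := (Finset.range (m * p ^ r)).filter (fun i => ¬ p ∣ i)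
  set x : ℤ_[p] := ∑ i ∈ s, (i : ℤ_[p]).inv ^ j with hx
  have hmap : PadicInt.toZModPow r x = 0 := by
    rw [hx, map_sum, ← ZMod.sum_range_filter_inv_pow_eq_zero hjd m hr0]
    refine Finset.sum_congr rfl fun i hi => ?_
    have h := congrArg (PadicInt.toZModPow r) (PadicInt.mul_inv (hnorm (Finset.mem_filter.1 hi).2))
    rw [map_mul, map_natCast, map_one] at h
    rw [map_pow, ZMod.inv_eq_of_mul_eq_one _ _ _ h]
  have hxS : ((Ssum p j (m * p ^ r) : ℚ) : ℚ_[p]) = x := by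
    rw [Ssum, hIcc, hx, PadicInt.coe_sum, Rat.cast_sum]
    refine Finset.sum_congr rfl fun i hi => ?_
    have h := congrArg ((↑) : ℤ_[p] → ℚ_[p]) (PadicInt.mul_inv (hnorm (Finset.mem_filter.1 hi).2))
    push_cast at h ⊢
    rw [eq_inv_of_mul_eq_one_right h, one_div, inv_pow]
  rw [← RingHom.mem_ker, PadicInt.ker_toZModPow, ← PadicInt.norm_le_pow_iff_mem_span_pow,
    PadicInt.norm_def, ← hxS, Padic.eq_padicNorm] at hmap
  rw [← Rat.cast_le (K := ℝ), Rat.cast_zpow, Rat.cast_natCast]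
  exact hmap
end

section
/- Let p > 3 be a prime and A, B ≥ 0 integers. Then for all integers m, n ≥ 0 and r, s ≥ 0 with s ≤ r, the p-adic valuation of the rational number g*_{AB}(m·p^r, n·p^s) − 1 is at least r + 2s (i.e., g*_{AB}(m·p^r, n·p^s) ≡ 1 (mod p^(r+2s)) in the p-adic sense). -/
/-- `g*_{AB}(X, k) = ∏_{1 ≤ i ≤ k, p ∤ i} (1 - X/i)^A (1 + X/i)^B`. -/
def gStar (p A B : ℕ) (X : ℚ) (k : ℕ) : ℚ :=
  ∏ i ∈ (Finset.Icc 1 k).filter (fun i => ¬ p ∣ i),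
    (1 - X / (i : ℚ)) ^ A * (1 + X / (i : ℚ)) ^ B

/-- A product of `1 + y * a i` agrees with its linear part modulo `y ^ 2`. -/
theorem sq_dvd_prod_one_add_mul_sub {R ι : Type*} [CommRing R] (t : Finset ι) (y : R)
    (a : ι → R) :
    y ^ 2 ∣ ∏ i ∈ t, (1 + y * a i) - (1 + y * ∑ i ∈ t, a i) := by
  classical
  induction t using Finset.induction_on with
  | empty => simp
  | insert j t hj ih =>
    obtain ⟨c, hc⟩ := ih
    rw [Finset.prod_insert hj, Finset.sum_insert hj, sub_eq_iff_eq_add.mp hc]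
    exact ⟨c * (1 + y * a j) + a j * ∑ i ∈ t, a i, by ring⟩

theorem dvd_mul_sub_one {R : Type*} [CommRing R] {d a b : R} (ha : d ∣ a - 1)
    (hb : d ∣ b - 1) : d ∣ a * b - 1 := by
  have h : a * b - 1 = (a - 1) * b + (b - 1) := by ring
  exact h ▸ dvd_add (ha.mul_right b) hb

theorem dvd_pow_sub_one {R : Type*} [CommRing R] {d a : R} (ha : d ∣ a - 1) (n : ℕ) :
    d ∣ a ^ n - 1 := by
  induction n with
  | zero => simp
  | succ n ih => exact pow_succ a n ▸ dvd_mul_sub_one ih ha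

section InverseFamily

/-! In this section `v i` is an inverse of `i` in `R` for every `i` prime to `p`. -/

variable {R : Type*} [CommRing R] {p : ℕ} {v : ℕ → R}

theorem inverse_mul (hp : p.Prime) (hv : ∀ i, ¬ p ∣ i → (i : R) * v i = 1) {i j : ℕ}
    (hi : ¬ p ∣ i) (hj : ¬ p ∣ j) : v (i * j) = v i * v j := by
  have hij := hv (i * j) (fun h => (hp.dvd_mul.mp h).elim hi hj)
  push_cast at hij
  linear_combination (v i * v j) * hij - v (i * j) * hv j hj - v (i * j) * j * v j * hv i hi

theorem inverse_congr (hv : ∀ i, ¬ p ∣ i → (i : R) * v i = 1) {i j : ℕ}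
    (hi : ¬ p ∣ i) (hj : ¬ p ∣ j) (hij : (i : R) = j) : v i = v j := by
  linear_combination v j * hv i hi - v i * hv j hj - v i * v j * hij

/-- The inverse squares of a reduced residue system modulo `p ^ s` sum to zero in a ring in
which `p ^ s = 0`. -/
theorem sum_inverse_sq_range_pow_eq_zero (hp : p.Prime) (hp3 : 3 < p)
    (hv : ∀ i, ¬ p ∣ i → (i : R) * v i = 1) {s : ℕ} (hs : s ≠ 0)
    (hq : ((p ^ s : ℕ) : R) = 0) :
    ∑ i ∈ (Finset.range (p ^ s)).filter (fun i => ¬ p ∣ i), v i ^ 2 = 0 := by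
  set q := p ^ s
  have hpq : p ∣ q := dvd_pow_self p hs
  have hq0 : 0 < q := pow_pos hp.pos s
  have h2 : ¬ p ∣ 2 := fun h => by have := Nat.le_of_dvd two_pos h; omega
  have h3 : ¬ p ∣ 3 := fun h => by have := Nat.le_of_dvd three_pos h; omega
  have hcop : Nat.gcd q 2 = 1 := ((hp.coprime_iff_not_dvd.mpr h2).pow_left s)
  have hmod : ∀ k : ℕ, ((k % q : ℕ) : R) = k := fun k => by
    conv_rhs => rw [← Nat.mod_add_div k q]
    push_cast
    rw [hq]
    ring
  set U := (Finset.range q).filter (fun i => ¬ p ∣ i) with hU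
  have hunit : ∀ i, ¬ p ∣ i → ¬ p ∣ 2 * i % q := fun i hi h =>
    (hp.dvd_mul.mp ((Nat.dvd_mod_iff hpq).mp h)).elim h2 hi
  have hmaps : ∀ i ∈ U, 2 * i % q ∈ U := fun i hi => by
    rw [hU, Finset.mem_filter, Finset.mem_range] at hi ⊢
    exact ⟨Nat.mod_lt _ hq0, hunit i hi.2⟩
  have hinj : Set.InjOn (fun i => 2 * i % q) U := fun i hi j hj hij => by
    rw [hU, Finset.mem_coe, Finset.mem_filter, Finset.mem_range] at hi hj
    exact (Nat.ModEq.cancel_left_of_coprime hcop hij).eq_of_lt_of_lt hi.1 hj.1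
  have hperm : ∑ i ∈ U, v (2 * i % q) ^ 2 = ∑ i ∈ U, v i ^ 2 :=
    Finset.sum_nbij (fun i => 2 * i % q) hmaps hinj
      (Finset.surjOn_of_injOn_of_card_le _ hmaps hinj le_rfl) (fun _ _ => rfl)
  have hscale : ∑ i ∈ U, v (2 * i % q) ^ 2 = v 2 ^ 2 * ∑ i ∈ U, v i ^ 2 := by
    rw [Finset.mul_sum]
    refine Finset.sum_congr rfl fun i hi => ?_
    have hi' : ¬ p ∣ i := (Finset.mem_filter.mp hi).2
    rw [inverse_congr hv (hunit i hi') (fun h => (hp.dvd_mul.mp h).elim h2 hi') (hmod _),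
      inverse_mul hp hv h2 hi', mul_pow]
  have hv2 := hv 2 h2
  have hv3 := hv 3 h3
  push_cast at hv2 hv3
  set T := ∑ i ∈ U, v i ^ 2
  have hT : T = v 2 ^ 2 * T := hperm ▸ hscale
  have h3T : 3 * T = 0 := by
    linear_combination 4 * hT + (2 * v 2 + 1) * T * hv2
  linear_combination v 3 * h3T - T * hv3

theorem sum_inverse_sq_range_mul_eq_zero (hp : p.Prime) (hp3 : 3 < p)
    (hv : ∀ i, ¬ p ∣ i → (i : R) * v i = 1) {s : ℕ} (hs : s ≠ 0)
    (hq : ((p ^ s : ℕ) : R) = 0) (n : ℕ) :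
    ∑ i ∈ (Finset.range (n * p ^ s)).filter (fun i => ¬ p ∣ i), v i ^ 2 = 0 := by
  have hbase := sum_inverse_sq_range_pow_eq_zero hp hp3 hv hs hq
  rw [Finset.sum_filter] at hbase ⊢
  induction n with
  | zero => simp
  | succ n ih =>
    rw [Nat.succ_mul, Finset.sum_range_add, ih, zero_add]
    refine (Finset.sum_congr rfl fun i _ => ?_).trans hbase
    have hdvd : p ∣ n * p ^ s + i ↔ p ∣ i :=
      Nat.dvd_add_right ((dvd_pow_self p hs).mul_left n)
    by_cases hi : p ∣ i
    · simp [hdvd, hi]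
    · have hcast : ((n * p ^ s + i : ℕ) : R) = i := by
        rw [Nat.cast_add, Nat.cast_mul, hq]
        ring
      rw [if_pos (mt hdvd.mp hi), if_pos hi,
        inverse_congr hv (mt hdvd.mp hi) hi hcast]

theorem pow_dvd_sum_inverse_sq (hp : p.Prime) (hp3 : 3 < p)
    (hv : ∀ i, ¬ p ∣ i → (i : R) * v i = 1) {s : ℕ} (hs : s ≠ 0) (n : ℕ) :
    (p : R) ^ s ∣
      ∑ i ∈ (Finset.Icc 1 (n * p ^ s)).filter (fun i => ¬ p ∣ i), v i ^ 2 := by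
  have hset : (Finset.Icc 1 (n * p ^ s)).filter (fun i => ¬ p ∣ i) =
      (Finset.range (n * p ^ s)).filter (fun i => ¬ p ∣ i) := by
    ext i
    simp only [Finset.mem_filter, Finset.mem_Icc, Finset.mem_range]
    constructor
    · rintro ⟨⟨_, h⟩, hi⟩
      refine ⟨h.lt_of_ne ?_, hi⟩
      rintro rfl
      exact hi ((dvd_pow_self p hs).mul_left n)
    · rintro ⟨h, hi⟩
      refine ⟨⟨Nat.pos_of_ne_zero ?_, h.le⟩, hi⟩
      rintro rfl
      exact hi (dvd_zero p)
  rw [hset, ← Ideal.mem_span_singleton, ← Ideal.Quotient.eq_zero_iff_mem, map_sum]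
  simp only [map_pow]
  refine sum_inverse_sq_range_mul_eq_zero
    (v := fun i => Ideal.Quotient.mk (Ideal.span {(p : R) ^ s}) (v i)) hp hp3
    (fun i hi => ?_) hs ?_ n
  · rw [← map_natCast (Ideal.Quotient.mk (Ideal.span {(p : R) ^ s})), ← map_mul, hv i hi,
      map_one]
  · rw [← map_natCast (Ideal.Quotient.mk (Ideal.span {(p : R) ^ s})),
      Ideal.Quotient.eq_zero_iff_mem, Ideal.mem_span_singleton, Nat.cast_pow]

theorem prod_reflect_not_dvd {M : Type*} [CommMonoid M] {N : ℕ} (hN : p ∣ N) (f : ℕ → M) :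
    ∏ i ∈ (Finset.Icc 1 N).filter (fun i => ¬ p ∣ i), f (N - i) =
      ∏ i ∈ (Finset.Icc 1 N).filter (fun i => ¬ p ∣ i), f i := by
  have hmaps : ∀ i ∈ (Finset.Icc 1 N).filter (fun i => ¬ p ∣ i),
      N - i ∈ (Finset.Icc 1 N).filter (fun i => ¬ p ∣ i) := fun i hi => by
    simp only [Finset.mem_filter, Finset.mem_Icc] at hi ⊢
    have hNi : ¬ p ∣ N - i := fun h => hi.2 ((Nat.dvd_sub_iff_right hi.1.2 hN).mp h)
    refine ⟨⟨Nat.pos_of_ne_zero fun h => hNi (h ▸ dvd_zero p), Nat.sub_le N i⟩, hNi⟩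
  have hinv : ∀ i ∈ (Finset.Icc 1 N).filter (fun i => ¬ p ∣ i), N - (N - i) = i :=
    fun i hi => Nat.sub_sub_self (Finset.mem_Icc.mp (Finset.mem_filter.mp hi).1).2
  exact Finset.prod_nbij' (fun i => N - i) (fun i => N - i) hmaps hmaps hinv hinv
    (fun _ _ => rfl)

/-- Pairing `i` with `N - i` gives the square of the product modulo `p ^ (r + 2 * s)`. -/
theorem pow_dvd_prod_sq_sub_one (hp : p.Prime) (hp3 : 3 < p)
    (hv : ∀ i, ¬ p ∣ i → (i : R) * v i = 1) {r s : ℕ} (hs : s ≠ 0) (hsr : s ≤ r) (n : ℕ)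
    {x : R} (hx : (p : R) ^ r ∣ x) :
    (p : R) ^ (r + 2 * s) ∣
      (∏ i ∈ (Finset.Icc 1 (n * p ^ s)).filter (fun i => ¬ p ∣ i), (1 + x * v i)) ^ 2 - 1 := by
  set N := n * p ^ s with hN
  set t := (Finset.Icc 1 N).filter (fun i => ¬ p ∣ i) with ht
  have hpN : p ∣ N := (dvd_pow_self p hs).mul_left n
  have hNR : (p : R) ^ s ∣ (N : R) := ⟨n, by rw [hN]; push_cast; ring⟩
  have hmem : ∀ i ∈ t, (i : R) * v i = 1 ∧ ((N : R) - i) * v (N - i) = 1 := fun i hi => by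
    simp only [ht, Finset.mem_filter, Finset.mem_Icc] at hi
    refine ⟨hv i hi.2, ?_⟩
    rw [← Nat.cast_sub hi.1.2]
    exact hv _ fun h => hi.2 ((Nat.dvd_sub_iff_right hi.1.2 hpN).mp h)
  set y := x * (N + x)
  have hy : (p : R) ^ (r + s) ∣ y := by
    rw [pow_add]
    exact mul_dvd_mul hx (dvd_add hNR ((pow_dvd_pow _ hsr).trans hx))
  have hsq : (∏ i ∈ t, (1 + x * v i)) ^ 2 = ∏ i ∈ t, (1 + y * (v i * v (N - i))) := by
    have hrefl := prod_reflect_not_dvd hpN (fun i => 1 + x * v i)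
    rw [← ht] at hrefl
    rw [sq]
    nth_rewrite 2 [← hrefl]
    rw [← Finset.prod_mul_distrib]
    refine Finset.prod_congr rfl fun i hi => ?_
    obtain ⟨h1, h2⟩ := hmem i hi
    simp only [y]
    linear_combination (-x * v (N - i)) * h1 - x * v i * h2
  have hsum : (p : R) ^ s ∣ ∑ i ∈ t, v i * v (N - i) := by
    have h : ∑ i ∈ t, v i * v (N - i) =
        N * ∑ i ∈ t, v i ^ 2 * v (N - i) - ∑ i ∈ t, v i ^ 2 := by
      rw [Finset.mul_sum, ← Finset.sum_sub_distrib]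
      refine Finset.sum_congr rfl fun i hi => ?_
      obtain ⟨h1, h2⟩ := hmem i hi
      linear_combination (-v i * v (N - i)) * h1 - v i ^ 2 * h2
    rw [h]
    exact dvd_sub (hNR.mul_right _) (pow_dvd_sum_inverse_sq hp hp3 hv hs n)
  have hlin := sq_dvd_prod_one_add_mul_sub t y (fun i => v i * v (N - i))
  rw [hsq, ← sub_add_sub_cancel _ (1 + y * ∑ i ∈ t, v i * v (N - i)) 1, add_sub_cancel_left]
  refine dvd_add (Dvd.dvd.trans ?_ hlin) ?_
  · refine Dvd.dvd.trans ?_ (pow_dvd_pow_of_dvd hy 2)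
    rw [← pow_mul]
    exact pow_dvd_pow _ (by omega)
  · rw [show r + 2 * s = (r + s) + s by ring, pow_add _ (r + s)]
    exact mul_dvd_mul hy hsum

theorem pow_dvd_prod_one_add_mul_inverse_sub_one (hp : p.Prime) (hp3 : 3 < p)
    (hv : ∀ i, ¬ p ∣ i → (i : R) * v i = 1) {r s : ℕ} (hsr : s ≤ r) (n : ℕ)
    {x : R} (hx : (p : R) ^ r ∣ x) :
    (p : R) ^ (r + 2 * s) ∣
      ∏ i ∈ (Finset.Icc 1 (n * p ^ s)).filter (fun i => ¬ p ∣ i), (1 + x * v i) - 1 := by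
  set P := ∏ i ∈ (Finset.Icc 1 (n * p ^ s)).filter (fun i => ¬ p ∣ i), (1 + x * v i)
  have hP : (p : R) ^ r ∣ P - 1 :=
    Finset.prod_induction _ (fun a => (p : R) ^ r ∣ a - 1) (fun _ _ => dvd_mul_sub_one)
      (by simp) fun i _ => by simpa using hx.mul_right (v i)
  rcases eq_or_ne s 0 with rfl | hs
  · simpa using hP
  have h2 := hv 2 fun h => by have := Nat.le_of_dvd two_pos h; omega
  push_cast at h2
  obtain ⟨c, hc⟩ : (p : R) ∣ P - 1 :=
    (dvd_pow_self _ (by omega)).trans hP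
  have hcop : IsCoprime (p : R) (P + 1) := ⟨-(c * v 2), v 2, by
    linear_combination v 2 * hc + h2⟩
  refine (hcop.pow_left (m := r + 2 * s)).dvd_of_dvd_mul_left ?_
  have h := pow_dvd_prod_sq_sub_one hp hp3 hv hs hsr n hx
  rwa [show P ^ 2 - 1 = (P + 1) * (P - 1) by ring] at h

end InverseFamily

/-- `g*_{AB}(m p^r, n p^s) ≡ 1 (mod p^{r+2s})` in the `p`-adic sense. -/
theorem gStar_padic_congruence (p : ℕ) (hp : p.Prime) (hp3 : 3 < p)
    (A B : ℕ) (m n r s : ℕ) (hsr : s ≤ r) :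
    padicNorm p (gStar p A B ((m : ℚ) * (p : ℚ) ^ r) (n * p ^ s) - 1) ≤
      (p : ℚ) ^ (-(r + 2 * s : ℤ)) := by
  have : Fact p.Prime := ⟨hp⟩
  let v : ℕ → ℤ_[p] := fun i => Ring.inverse (i : ℤ_[p])
  have hv : ∀ i, ¬ p ∣ i → (i : ℤ_[p]) * v i = 1 := fun i hi =>
    Ring.mul_inverse_cancel _
      (PadicInt.isUnit_iff.mpr
        (PadicInt.norm_natCast_eq_one_iff.mpr (hp.coprime_iff_not_dvd.mpr hi)))
  let x : ℤ_[p] := m * p ^ r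
  have hx : (p : ℤ_[p]) ^ r ∣ x := dvd_mul_left _ _
  let t := (Finset.Icc 1 (n * p ^ s)).filter (fun i => ¬ p ∣ i)
  let G : ℤ_[p] := (∏ i ∈ t, (1 + -x * v i)) ^ A * (∏ i ∈ t, (1 + x * v i)) ^ B
  have hG : (p : ℤ_[p]) ^ (r + 2 * s) ∣ G - 1 := dvd_mul_sub_one
    (dvd_pow_sub_one
      (pow_dvd_prod_one_add_mul_inverse_sub_one hp hp3 hv hsr n ((dvd_neg).mpr hx)) A)
    (dvd_pow_sub_one (pow_dvd_prod_one_add_mul_inverse_sub_one hp hp3 hv hsr n hx) B)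
  have hcast : ((gStar p A B ((m : ℚ) * (p : ℚ) ^ r) (n * p ^ s) : ℚ) : ℚ_[p]) = G := by
    have hvi : ∀ i ∈ t, ((v i : ℤ_[p]) : ℚ_[p]) = (i : ℚ_[p])⁻¹ := fun i hi =>
      eq_inv_of_mul_eq_one_right (by
        exact_mod_cast congrArg ((↑) : ℤ_[p] → ℚ_[p]) (hv i (Finset.mem_filter.mp hi).2))
    simp only [G, ← Finset.prod_pow, ← Finset.prod_mul_distrib, gStar]
    rw [Rat.cast_prod]
    refine Eq.trans (Finset.prod_congr rfl fun i hi => ?_)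
      (map_prod (PadicInt.Coe.ringHom (p := p)) _ t).symm
    change _ = (((1 + -x * v i) ^ A * (1 + x * v i) ^ B : ℤ_[p]) : ℚ_[p])
    push_cast
    rw [hvi i hi]
    simp only [x]
    push_cast
    ring
  have hnorm := (PadicInt.norm_le_pow_iff_mem_span_pow _ _).mpr
    (Ideal.mem_span_singleton.mpr hG)
  rw [PadicInt.norm_def, PadicInt.coe_sub, PadicInt.coe_one, ← hcast, ← Rat.cast_one,
    ← Rat.cast_sub, Padic.eq_padicNorm] at hnorm
  rw [← Rat.cast_le (K := ℝ)]
  push_cast at hnorm ⊢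
  exact hnorm
end

section
/- Let p > 3 be a prime, A ≥ 2 and C ≥ 1 integers, and let m, n, r, s be integers with m, n ≥ 1, r ≥ s ≥ 1, p ∤ m, p ∤ n, and n·p^s ≤ m·p^r. Then, as an identity of rational numbers, C(m·p^r, n·p^s)^(A+2C) = C(m·p^(r−1), n·p^(s−1))^(A+2C) · g*_{(A+2C) 0}(m·p^r, n·p^s). -/
/-- The recursion `(k + 1) * N.choose (k + 1) = (N - k) * N.choose k`, iterated `j` times. -/
theorem cast_choose_add_mul_prod (N k j : ℕ) :
    (N.choose (k + j) : ℚ) * ∏ i ∈ Finset.range j, ((k : ℚ) + i + 1) =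
      N.choose k * ∏ i ∈ Finset.range j, ((N : ℚ) - k - i) := by
  induction j with
  | zero => simp
  | succ j ih =>
    have step : (N.choose (k + j + 1) : ℚ) * (k + j + 1) =
        N.choose (k + j) * ((N : ℚ) - k - j) := by
      rcases le_or_gt (k + j) N with h | h
      · have := Nat.choose_succ_right_eq N (k + j)
        have := congrArg (Nat.cast : ℕ → ℚ) this
        push_cast [Nat.cast_sub h] at this
        linear_combination this
      · rw [Nat.choose_eq_zero_of_lt h, Nat.choose_eq_zero_of_lt (by omega)]
        simp
    rw [Finset.prod_range_succ, Finset.prod_range_succ, ← add_assoc k j 1]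
    linear_combination (∏ i ∈ Finset.range j, ((k : ℚ) + i + 1)) * step +
      ((N : ℚ) - k - j) * ih

/-- A block of `p` consecutive indices following a multiple of `p` contributes `p - 1` factors. -/
theorem prod_filter_not_dvd_mul_succ {p : ℕ} (hp : 0 < p) (K : ℕ) (f : ℕ → ℚ) :
    ∏ i ∈ (Finset.Icc 1 (p * (K + 1))).filter (fun i => ¬ p ∣ i), f i =
      (∏ i ∈ (Finset.Icc 1 (p * K)).filter (fun i => ¬ p ∣ i), f i) *
        ∏ i ∈ Finset.range (p - 1), f (p * K + i + 1) := by
  obtain ⟨q, rfl⟩ : ∃ q, p = q + 1 := ⟨p - 1, by omega⟩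
  have initial_block : ∀ j ≤ q,
      ∏ i ∈ (Finset.Icc 1 ((q + 1) * K + j)).filter (fun i => ¬ (q + 1) ∣ i), f i =
        (∏ i ∈ (Finset.Icc 1 ((q + 1) * K)).filter (fun i => ¬ (q + 1) ∣ i), f i) *
          ∏ i ∈ Finset.range j, f ((q + 1) * K + i + 1) := by
    intro j
    induction j with
    | zero => simp
    | succ j ih =>
      intro hj
      have hnd : ¬ (q + 1) ∣ (q + 1) * K + j + 1 := by
        rw [add_assoc, Nat.dvd_add_right (dvd_mul_right _ _)]
        exact Nat.not_dvd_of_pos_of_lt (by omega) (by omega)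
      rw [Finset.prod_filter, ← add_assoc, Finset.prod_Icc_succ_top (by omega),
        ← Finset.prod_filter, if_pos hnd, ih (by omega), Finset.prod_range_succ, mul_assoc]
  rw [show (q + 1) * (K + 1) = (q + 1) * K + q + 1 by ring, Finset.prod_filter,
    Finset.prod_Icc_succ_top (by omega), ← Finset.prod_filter, initial_block q le_rfl,
    if_neg (not_not.mpr ⟨K + 1, by ring⟩), mul_one, Nat.add_sub_cancel]

/-- For an odd prime `p`, the quotient of `(pM).choose (pK)` by `M.choose K` is the product of
`1 - pM / i` over the indices `i ≤ pK` prime to `p`. -/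
theorem choose_prime_mul_prime_mul {p : ℕ} (hp : p.Prime) (hp2 : p ≠ 2) (M K : ℕ) :
    ((p * M).choose (p * K) : ℚ) = M.choose K *
      ∏ i ∈ (Finset.Icc 1 (p * K)).filter (fun i => ¬ p ∣ i), (1 - (p : ℚ) * M / i) := by
  induction K with
  | zero => simp
  | succ K ih =>
    have heven : Even (p - 1) := hp.even_sub_one hp2
    have big := cast_choose_add_mul_prod (p * M) (p * K) p
    have small := cast_choose_add_mul_prod M K 1
    rw [prod_filter_not_dvd_mul_succ hp.pos]
    rw [← mul_add_one] at big
    obtain ⟨q, rfl⟩ : ∃ q, p = q + 1 := ⟨p - 1, by have := hp.pos; omega⟩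
    rw [Nat.add_sub_cancel] at heven ⊢
    rw [Finset.prod_range_succ, Finset.prod_range_succ', ih] at big
    set P := ∏ i ∈ (Finset.Icc 1 ((q + 1) * K)).filter (fun i => ¬ (q + 1) ∣ i),
      (1 - ((q + 1 : ℕ) : ℚ) * M / i)
    set D := ∏ i ∈ Finset.range q, ((((q + 1) * K : ℕ) : ℚ) + i + 1) with hD
    have hD0 : D ≠ 0 := Finset.prod_ne_zero_iff.mpr fun i _ => by positivity
    have block : (∏ i ∈ Finset.range q,
          (1 - ((q + 1 : ℕ) : ℚ) * M / (((q + 1) * K + i + 1 : ℕ) : ℚ))) * D =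
        ∏ i ∈ Finset.range q,
          ((((q + 1) * M : ℕ) : ℚ) - ((q + 1) * K : ℕ) - ((i + 1 : ℕ) : ℚ)) := by
      have sign (g : ℕ → ℚ) : ∏ i ∈ Finset.range q, g i = ∏ i ∈ Finset.range q, -g i := by
        rw [Finset.prod_neg, Finset.card_range, heven.neg_one_pow, one_mul]
      rw [hD, ← Finset.prod_mul_distrib, sign]
      refine Finset.prod_congr rfl fun i _ => ?_
      have : ((q : ℚ) + 1) * K + i + 1 ≠ 0 := by positivity
      push_cast
      field_simp
      ring
    rw [← block] at big
    set R := ∏ i ∈ Finset.range q,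
      (1 - ((q + 1 : ℕ) : ℚ) * M / (((q + 1) * K + i + 1 : ℕ) : ℚ))
    simp only [Finset.prod_range_one] at small
    have hK : ((q : ℚ) + 1) * (K + 1) ≠ 0 := by positivity
    push_cast at big small
    apply mul_right_cancel₀ (mul_ne_zero hD0 hK)
    linear_combination big - ((q : ℚ) + 1) * P * R * D * small

theorem gStar_zero_right (p A : ℕ) (X : ℚ) (k : ℕ) :
    gStar p A 0 X k =
      (∏ i ∈ (Finset.Icc 1 k).filter (fun i => ¬ p ∣ i), (1 - X / (i : ℚ))) ^ A := by
  simp [gStar, Finset.prod_pow]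

/-- `C(m p^r, n p^s)^{A+2C} = C(m p^{r-1}, n p^{s-1})^{A+2C} g*_{(A+2C)0}(m p^r, n p^s)`. -/
theorem choose_pow_eq_choose_pow_mul_gStar (p : ℕ) (hp : p.Prime) (hp3 : 3 < p)
    (A C : ℕ) (hA : 2 ≤ A) (hC : 1 ≤ C)
    (m n r s : ℕ) (hm : 1 ≤ m) (hn : 1 ≤ n) (hs : 1 ≤ s) (hsr : s ≤ r)
    (hpm : ¬ p ∣ m) (hpn : ¬ p ∣ n) (hle : n * p ^ s ≤ m * p ^ r) :
    (((m * p ^ r).choose (n * p ^ s) : ℚ)) ^ (A + 2 * C) =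
      (((m * p ^ (r - 1)).choose (n * p ^ (s - 1)) : ℚ)) ^ (A + 2 * C) *
        gStar p (A + 2 * C) 0 ((m : ℚ) * (p : ℚ) ^ r) (n * p ^ s) := by
  have hX : (m : ℚ) * (p : ℚ) ^ r = (p : ℚ) * ((m * p ^ (r - 1) : ℕ) : ℚ) := by
    obtain ⟨t, rfl⟩ : ∃ t, r = t + 1 := ⟨r - 1, by omega⟩
    push_cast [Nat.add_sub_cancel]
    ring
  have hN : m * p ^ r = p * (m * p ^ (r - 1)) := by exact_mod_cast hX
  have hk : n * p ^ s = p * (n * p ^ (s - 1)) := by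
    obtain ⟨t, rfl⟩ : ∃ t, s = t + 1 := ⟨s - 1, by omega⟩
    rw [Nat.add_sub_cancel]
    ring
  rw [gStar_zero_right, ← mul_pow, hX, hN, hk, ← choose_prime_mul_prime_mul hp (by omega)]
end

section
/- Let p > 3 be a prime, C ≥ 1 an integer, and let m, n, r, s be integers with m, n ≥ 1, r ≥ s ≥ 1, p ∤ m, p ∤ n, and n·p^s ≤ m·p^r. Then, as an identity of rational numbers, C(2m·p^r, 2n·p^s)^C = C(2m·p^(r−1), 2n·p^(s−1))^C · g*_{C 0}(2m·p^r, 2n·p^s). -/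
/-- The absorption identity `k C(N, k) = N C(N-1, k-1)`, with `C(N-1, k-1)` as a signed product. -/
theorem mul_choose_eq_mul_prod_one_sub_div (N : ℕ) {k : ℕ} (hk : 1 ≤ k) :
    (k : ℚ) * (N.choose k : ℚ) =
      N * ((-1) ^ (k - 1) * ∏ i ∈ Finset.Ico 1 k, (1 - (N : ℚ) / (i : ℚ))) := by
  induction k, hk using Nat.le_induction with
  | base => simp
  | succ k hk ih =>
    have hk0 : (k : ℚ) ≠ 0 := by positivity
    have hsucc : ((k + 1 : ℕ) : ℚ) * (N.choose (k + 1) : ℚ) = (N - k) * (N.choose k : ℚ) := by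
      rcases le_or_gt k N with h | h
      · have := Nat.choose_succ_right_eq N k
        have := congrArg (Nat.cast (R := ℚ)) this
        push_cast [Nat.cast_sub h] at this ⊢
        linarith
      · simp [Nat.choose_eq_zero_of_lt h, Nat.choose_eq_zero_of_lt (h.trans (Nat.lt_succ_self k))]
    rw [hsucc, Finset.prod_Ico_succ_top hk]
    obtain ⟨j, rfl⟩ := Nat.exists_eq_add_of_le' hk
    simp only [Nat.add_sub_cancel] at ih ⊢
    apply mul_left_cancel₀ hk0
    rw [mul_left_comm, ih, pow_succ]
    field_simp
    ring

theorem filter_dvd_Ico_one_mul {p : ℕ} (hp : 0 < p) (K : ℕ) :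
    (Finset.Ico 1 (p * K)).filter (fun i => p ∣ i) = (Finset.Ico 1 K).image (p * ·) := by
  ext i
  simp only [Finset.mem_filter, Finset.mem_Ico, Finset.mem_image]
  constructor
  · rintro ⟨⟨h1, h2⟩, j, rfl⟩
    exact ⟨j, ⟨Nat.pos_of_mul_pos_left h1, Nat.lt_of_mul_lt_mul_left h2⟩, rfl⟩
  · rintro ⟨j, ⟨h1, h2⟩, rfl⟩
    exact ⟨⟨Nat.mul_pos hp h1, Nat.mul_lt_mul_of_pos_left h2 hp⟩, dvd_mul_right _ _⟩

theorem filter_not_dvd_Icc_one_mul (p K : ℕ) :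
    (Finset.Icc 1 (p * K)).filter (fun i => ¬ p ∣ i) =
      (Finset.Ico 1 (p * K)).filter (fun i => ¬ p ∣ i) := by
  ext i
  simp only [Finset.mem_filter, Finset.mem_Ico, Finset.mem_Icc, and_congr_left_iff]
  intro hi
  have : i ≠ p * K := by rintro rfl; exact hi (dvd_mul_right _ _)
  omega

theorem prod_one_sub_div_Ico_mul {p : ℕ} (hp : 0 < p) (M K : ℕ) :
    ∏ i ∈ Finset.Ico 1 (p * K), (1 - ((p * M : ℕ) : ℚ) / (i : ℚ)) =
      (∏ i ∈ Finset.Ico 1 K, (1 - (M : ℚ) / (i : ℚ))) * gStar p 1 0 ((p * M : ℕ) : ℚ) (p * K) := by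
  have hp0 : (p : ℚ) ≠ 0 := by positivity
  rw [← Finset.prod_filter_mul_prod_filter_not _ (fun i => p ∣ i), filter_dvd_Ico_one_mul hp,
    Finset.prod_image (fun a _ b _ h => Nat.eq_of_mul_eq_mul_left hp h), gStar,
    filter_not_dvd_Icc_one_mul]
  congr 1
  · refine Finset.prod_congr rfl fun i _ => ?_
    push_cast
    rw [mul_div_mul_left _ _ hp0]
  · simp

theorem choose_mul_eq_choose_mul_gStar {p : ℕ} (hp : 0 < p) (M : ℕ) {K : ℕ} (hK : 1 ≤ K)
    (hKe : Even K) :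
    ((p * M).choose (p * K) : ℚ) =
      (M.choose K : ℚ) * gStar p 1 0 ((p * M : ℕ) : ℚ) (p * K) := by
  have hpK : 1 ≤ p * K := Nat.mul_pos hp hK
  have h1 := mul_choose_eq_mul_prod_one_sub_div (p * M) hpK
  have h2 := mul_choose_eq_mul_prod_one_sub_div M hK
  rw [prod_one_sub_div_Ico_mul hp, (Nat.Even.sub_odd hpK (hKe.mul_left p) odd_one).neg_one_pow] at h1
  rw [(Nat.Even.sub_odd hK hKe odd_one).neg_one_pow] at h2
  have hne : ((p * K : ℕ) : ℚ) ≠ 0 := by positivity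
  apply mul_left_cancel₀ hne
  rw [h1]
  push_cast
  linear_combination -(p : ℚ) * gStar p 1 0 ((p : ℚ) * M) (p * K) * h2

theorem gStar_zero_right_eq_pow (p C : ℕ) (X : ℚ) (k : ℕ) :
    gStar p C 0 X k = gStar p 1 0 X k ^ C := by
  simp [gStar, Finset.prod_pow]

/-- `C(2m p^r, 2n p^s)^C = C(2m p^{r-1}, 2n p^{s-1})^C g*_{C0}(2m p^r, 2n p^s)`. -/
theorem choose_two_pow_eq_choose_pow_mul_gStar (p : ℕ) (hp : p.Prime) (hp3 : 3 < p)
    (C : ℕ) (hC : 1 ≤ C)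
    (m n r s : ℕ) (hm : 1 ≤ m) (hn : 1 ≤ n) (hs : 1 ≤ s) (hsr : s ≤ r)
    (hpm : ¬ p ∣ m) (hpn : ¬ p ∣ n) (hle : n * p ^ s ≤ m * p ^ r) :
    (((2 * m * p ^ r).choose (2 * n * p ^ s) : ℚ)) ^ C =
      (((2 * m * p ^ (r - 1)).choose (2 * n * p ^ (s - 1)) : ℚ)) ^ C *
        gStar p C 0 (2 * (m : ℚ) * (p : ℚ) ^ r) (2 * n * p ^ s) := by
  obtain ⟨r, rfl⟩ := Nat.exists_eq_add_of_le' (hs.trans hsr)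
  obtain ⟨s, rfl⟩ := Nat.exists_eq_add_of_le' hs
  simp only [Nat.add_sub_cancel]
  have hK : 1 ≤ 2 * n * p ^ s := Nat.mul_pos (by omega) (pow_pos hp.pos s)
  have key := choose_mul_eq_choose_mul_gStar hp.pos (2 * m * p ^ r) hK ⟨n * p ^ s, by ring⟩
  have eM : p * (2 * m * p ^ r) = 2 * m * p ^ (r + 1) := by ring
  have eK : p * (2 * n * p ^ s) = 2 * n * p ^ (s + 1) := by ring
  rw [eM, eK] at key
  rw [gStar_zero_right_eq_pow, key, mul_pow]
  push_cast
  rfl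
end
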